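/- In the two-dimensional Silver Dollar game without pushing and with jumps allowed (two coins on an unbounded board, a move slides one coin any number of squares to the left or upward, a coin slid off the board is removed from play, a coin may jump over the other coin but may not land on it; the player unable to move loses), the set of P-positions is exactly (P₀ ∪ P₁) − N₀, where P₀ = {(w,x,y,z) : (w-1) ⊕ (x-1) ⊕ (y-1) ⊕ (z-1) = 0}, P₁ = {(w,2n-1,w,2n) : w,n ∈ ℕ} ∪ {(w,2n,w,2n-1) : w,n ∈ ℕ} ∪ {(2n-1,x,2n,x) : x,n ∈ ℕ} ∪ {(2n,x,2n-1,x) : x,n ∈ ℕ}, and N₀ = {(2m,2n,2m-1,2n-1) : m,n ∈ ℕ} ∪ {(2m,2n-1,2m-1,2n) : m,n ∈ ℕ} ∪ {(2m-1,2n-1,2m,2n) : m,n ∈ ℕ} ∪ {(2m-1,2n,2m,2n-1) : m,n ∈ ℕ}. -/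

import Mathlib

mutual
  /-- P-position: the previous player (who just moved) can force a win. -/
  inductive PPosition {α : Type} (Move : α → α → Prop) : α → Prop
    | intro (p : α) (h : ∀ q, Move p q → NPosition Move q) : PPosition Move p
  /-- N-position: the player to move can force a win. -/
  inductive NPosition {α : Type} (Move : α → α → Prop) : α → Prop
    | intro (p q : α) (h : Move p q) (hq : PPosition Move q) : NPosition Move p
end

/-- A coin on the board at column `w`, row `x` (both `≥ 1` when on the board);
if either coordinate is `0` the coin has slid off the board and is removed (`none`). -/
def coin (w x : ℕ) : Option (ℕ × ℕ) := if w = 0 ∨ x = 0 then none else some (w, x)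

/-- Moves of the two-dimensional Silver Dollar game without pushing: a move slides one
coin any number of squares to the left or upward; a coin slid off the board is removed;
a coin may jump over the other coin but may not land on it. -/
inductive JumpMove :
    Option (ℕ × ℕ) × Option (ℕ × ℕ) → Option (ℕ × ℕ) × Option (ℕ × ℕ) → Prop
  | left₁ (w x t : ℕ) (c : Option (ℕ × ℕ)) (ht : t < w)
      (hc : coin t x = none ∨ coin t x ≠ c) :
      JumpMove (some (w, x), c) (coin t x, c)
  | up₁ (w x t : ℕ) (c : Option (ℕ × ℕ)) (ht : t < x)
      (hc : coin w t = none ∨ coin w t ≠ c) :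
      JumpMove (some (w, x), c) (coin w t, c)
  | left₂ (w x t : ℕ) (c : Option (ℕ × ℕ)) (ht : t < w)
      (hc : coin t x = none ∨ coin t x ≠ c) :
      JumpMove (c, some (w, x)) (c, coin t x)
  | up₂ (w x t : ℕ) (c : Option (ℕ × ℕ)) (ht : t < x)
      (hc : coin w t = none ∨ coin w t ≠ c) :
      JumpMove (c, some (w, x)) (c, coin w t)

/-- `P₀ = {(w,x,y,z) : (w-1) ⊕ (x-1) ⊕ (y-1) ⊕ (z-1) = 0}`. -/
def P0 : Set (ℕ × ℕ × ℕ × ℕ) :=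
  {p | (p.1 - 1) ^^^ (p.2.1 - 1) ^^^ (p.2.2.1 - 1) ^^^ (p.2.2.2 - 1) = 0}

/-- `P₁ = {(w,2n-1,w,2n)} ∪ {(w,2n,w,2n-1)} ∪ {(2n-1,x,2n,x)} ∪ {(2n,x,2n-1,x)}`,
with `w, x, n` ranging over the positive integers. -/
def P1 : Set (ℕ × ℕ × ℕ × ℕ) :=
  {p | ∃ w n : ℕ, 1 ≤ w ∧ 1 ≤ n ∧ p = (w, 2 * n - 1, w, 2 * n)} ∪
  {p | ∃ w n : ℕ, 1 ≤ w ∧ 1 ≤ n ∧ p = (w, 2 * n, w, 2 * n - 1)} ∪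
  {p | ∃ x n : ℕ, 1 ≤ x ∧ 1 ≤ n ∧ p = (2 * n - 1, x, 2 * n, x)} ∪
  {p | ∃ x n : ℕ, 1 ≤ x ∧ 1 ≤ n ∧ p = (2 * n, x, 2 * n - 1, x)}

/-- `N₀ = {(2m,2n,2m-1,2n-1)} ∪ {(2m,2n-1,2m-1,2n)} ∪ {(2m-1,2n-1,2m,2n)} ∪
{(2m-1,2n,2m,2n-1)}`, with `m, n` ranging over the positive integers. -/
def N0 : Set (ℕ × ℕ × ℕ × ℕ) :=
  {p | ∃ m n : ℕ, 1 ≤ m ∧ 1 ≤ n ∧ p = (2 * m, 2 * n, 2 * m - 1, 2 * n - 1)} ∪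
  {p | ∃ m n : ℕ, 1 ≤ m ∧ 1 ≤ n ∧ p = (2 * m, 2 * n - 1, 2 * m - 1, 2 * n)} ∪
  {p | ∃ m n : ℕ, 1 ≤ m ∧ 1 ≤ n ∧ p = (2 * m - 1, 2 * n - 1, 2 * m, 2 * n)} ∪
  {p | ∃ m n : ℕ, 1 ≤ m ∧ 1 ≤ n ∧ p = (2 * m - 1, 2 * n, 2 * m, 2 * n - 1)}

theorem PPosition.not_nPosition {α : Type} {Move : α → α → Prop} {p : α}
    (hp : PPosition Move p) : ¬ NPosition Move p := by
  refine PPosition.rec (motive_1 := fun p _ => ¬ NPosition Move p)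
    (motive_2 := fun p _ => ¬ PPosition Move p) ?_ ?_ hp
  · rintro p _ ih ⟨_, q, hm, hq⟩
    exact ih q hm hq
  · rintro p q hm _ ih ⟨_, h⟩
    exact ih (h q hm)

@[simp] theorem coin_zero_left (x : ℕ) : coin 0 x = none := by simp [coin]

@[simp] theorem coin_zero_right (w : ℕ) : coin w 0 = none := by simp [coin]

@[simp] theorem coin_succ (a b : ℕ) : coin (a + 1) (b + 1) = some (a + 1, b + 1) := by
  simp [coin]

theorem pPosition_none_none : PPosition JumpMove (none, none) :=
  .intro _ fun q h => by cases h

theorem nPosition_none_some (a b : ℕ) :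
    NPosition JumpMove (none, some (a + 1, b + 1)) :=
  .intro _ (none, none) (by simpa using JumpMove.left₂ (a + 1) (b + 1) 0 none) pPosition_none_none

theorem nPosition_some_none (a b : ℕ) :
    NPosition JumpMove (some (a + 1, b + 1), none) :=
  .intro _ (none, none) (by simpa using JumpMove.left₁ (a + 1) (b + 1) 0 none) pPosition_none_none

/-- The position whose coins have zero-based coordinates `(a, b)` and `(c, d)`. -/
abbrev coinPair (a b c d : ℕ) : Option (ℕ × ℕ) × Option (ℕ × ℕ) :=
  (some (a + 1, b + 1), some (c + 1, d + 1))

/-- A property of all options of a two-coin position, split into the four slides that keep both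
coins on the board and the two kinds of removal. -/
theorem forall_jumpMove_coinPair {a b c d : ℕ} {Q : Option (ℕ × ℕ) × Option (ℕ × ℕ) → Prop}
    (h₁ : Q (none, some (c + 1, d + 1))) (h₂ : Q (some (a + 1, b + 1), none))
    (ha : ∀ t < a, (t, b) ≠ (c, d) → Q (coinPair t b c d))
    (hb : ∀ t < b, (a, t) ≠ (c, d) → Q (coinPair a t c d))
    (hc : ∀ t < c, (a, b) ≠ (t, d) → Q (coinPair a b t d))
    (hd : ∀ t < d, (a, b) ≠ (c, t) → Q (coinPair a b c t)) :
    ∀ q, JumpMove (coinPair a b c d) q → Q q := by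
  intro q h
  cases h with
  | left₁ _ _ t _ ht hne =>
    cases t with
    | zero => simpa using h₁
    | succ t => simpa using ha t (by omega) (by simpa using hne)
  | up₁ _ _ t _ ht hne =>
    cases t with
    | zero => simpa using h₁
    | succ t => simpa using hb t (by omega) (by simpa using hne)
  | left₂ _ _ t _ ht hne =>
    cases t with
    | zero => simpa using h₂
    | succ t => simpa using hc t (by omega) (by simpa [eq_comm] using hne)
  | up₂ _ _ t _ ht hne =>
    cases t with
    | zero => simpa using h₂
    | succ t => simpa using hd t (by omega) (by simpa [eq_comm] using hne)

/-- The characterization of P-positions in zero-based coordinates: the nim-sums of the columns and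
of the rows correspond under the transposition of `0` and `1`. -/
def IsBalanced (a b c d : ℕ) : Prop := Equiv.swap 0 1 (a ^^^ c) = b ^^^ d

theorem IsBalanced.ne {a b c d : ℕ} (h : IsBalanced a b c d) : (a, b) ≠ (c, d) := by
  rintro ⟨⟩
  simp [IsBalanced] at h

theorem swap_zero_one_lt {u v : ℕ} (h : Equiv.swap 0 1 u ≠ v) (h0 : ¬ (u = 0 ∧ v = 0)) :
    Equiv.swap 0 1 v < u ∨ Equiv.swap 0 1 u < v := by
  simp only [Equiv.swap_apply_def] at h ⊢
  split_ifs at h ⊢ <;> omega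

theorem exists_isBalanced {a b c d : ℕ} (hne : (a, b) ≠ (c, d)) (h : ¬ IsBalanced a b c d) :
    (∃ t < a, IsBalanced t b c d) ∨ (∃ t < b, IsBalanced a t c d) ∨
      (∃ t < c, IsBalanced a b t d) ∨ (∃ t < d, IsBalanced a b c t) := by
  rcases swap_zero_one_lt h (by simpa [Nat.xor_eq_zero_iff] using hne) with hu | hv
  · rcases Nat.lt_xor_cases hu with ht | ht
    · exact .inl ⟨_, ht, by simp [IsBalanced]⟩
    · exact .inr (.inr (.inl ⟨_, ht, by simp [IsBalanced, Nat.xor_comm _ a]⟩))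
  · rcases Nat.lt_xor_cases hv with ht | ht
    · exact .inr (.inl ⟨_, ht, by simp [IsBalanced]⟩)
    · exact .inr (.inr (.inr ⟨_, ht, by simp [IsBalanced, Nat.xor_comm _ b]⟩))

theorem position_of_isBalanced (a b c d : ℕ) (hne : (a, b) ≠ (c, d)) :
    (IsBalanced a b c d → PPosition JumpMove (coinPair a b c d)) ∧
      (¬ IsBalanced a b c d → NPosition JumpMove (coinPair a b c d)) := by
  induction hn : a + b + c + d using Nat.strong_induction_on generalizing a b c d with
  | _ n ih =>
  subst hn
  constructor
  · intro h
    refine .intro _ (forall_jumpMove_coinPair (nPosition_none_some c d) (nPosition_some_none a b)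
      ?_ ?_ ?_ ?_) <;> intro t ht hne' <;> refine (ih _ (by omega) _ _ _ _ hne' rfl).2 fun h' => ?_
    · have := (Equiv.swap 0 1).injective (h.trans h'.symm)
      exact ht.ne' (Nat.xor_left_injective this)
    · exact ht.ne' (Nat.xor_left_injective (h.symm.trans h'))
    · have := (Equiv.swap 0 1).injective (h.trans h'.symm)
      exact ht.ne' (Nat.xor_right_injective this)
    · exact ht.ne' (Nat.xor_right_injective (h.symm.trans h'))
  · intro h
    rcases exists_isBalanced hne h with ⟨t, ht, h'⟩ | ⟨t, ht, h'⟩ | ⟨t, ht, h'⟩ | ⟨t, ht, h'⟩ <;>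
      refine .intro _ _ ?_ ((ih _ (by omega) _ _ _ _ h'.ne rfl).1 h')
    · simpa using JumpMove.left₁ (a + 1) (b + 1) (t + 1) (some (c + 1, d + 1)) (by omega)
        (by simpa using h'.ne)
    · simpa using JumpMove.up₁ (a + 1) (b + 1) (t + 1) (some (c + 1, d + 1)) (by omega)
        (by simpa using h'.ne)
    · simpa using JumpMove.left₂ (c + 1) (d + 1) (t + 1) (some (a + 1, b + 1)) (by omega)
        (by simpa [eq_comm] using h'.ne)
    · simpa using JumpMove.up₂ (c + 1) (d + 1) (t + 1) (some (a + 1, b + 1)) (by omega)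
        (by simpa [eq_comm] using h'.ne)

theorem pPosition_coinPair_iff {a b c d : ℕ} (hne : (a, b) ≠ (c, d)) :
    PPosition JumpMove (coinPair a b c d) ↔ IsBalanced a b c d := by
  refine ⟨fun hp => ?_, (position_of_isBalanced a b c d hne).1⟩
  by_contra h
  exact hp.not_nPosition ((position_of_isBalanced a b c d hne).2 h)

theorem xor_eq_one_iff {a c : ℕ} :
    a ^^^ c = 1 ↔ ∃ n, 1 ≤ n ∧
      (a + 1 = 2 * n - 1 ∧ c + 1 = 2 * n ∨ a + 1 = 2 * n ∧ c + 1 = 2 * n - 1) := by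
  have hdiv : (a ^^^ c) / 2 = 0 ↔ a / 2 = c / 2 := by
    rw [Nat.xor_div_two, Nat.xor_eq_zero_iff]
  have hmod : (a ^^^ c) % 2 = (a + c) % 2 := Nat.xor_mod_two_eq
  constructor
  · exact fun h => ⟨a / 2 + 1, by omega, by omega⟩
  · rintro ⟨n, hn, h⟩
    omega

theorem mem_P0_iff {a b c d : ℕ} :
    (a + 1, b + 1, c + 1, d + 1) ∈ P0 ↔ a ^^^ c = b ^^^ d := by
  rw [← Nat.xor_eq_zero_iff]
  simp only [P0, Set.mem_ofPred_eq, Nat.add_sub_cancel]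
  rw [show a ^^^ b ^^^ c ^^^ d = a ^^^ c ^^^ (b ^^^ d) by ac_rfl]

theorem mem_P1_iff {a b c d : ℕ} :
    (a + 1, b + 1, c + 1, d + 1) ∈ P1 ↔
      a ^^^ c = 0 ∧ b ^^^ d = 1 ∨ a ^^^ c = 1 ∧ b ^^^ d = 0 := by
  simp only [P1, xor_eq_one_iff, Nat.xor_eq_zero_iff, Set.mem_union, Set.mem_ofPred_eq,
    Prod.mk.injEq]
  constructor
  · rintro (((⟨w, n, h⟩ | ⟨w, n, h⟩) | ⟨w, n, h⟩) | ⟨w, n, h⟩)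
    · exact .inl ⟨by omega, n, by omega⟩
    · exact .inl ⟨by omega, n, by omega⟩
    · exact .inr ⟨⟨n, by omega⟩, by omega⟩
    · exact .inr ⟨⟨n, by omega⟩, by omega⟩
  · rintro (⟨h, n, hn, h' | h'⟩ | ⟨⟨n, hn, h' | h'⟩, h⟩)
    · exact .inl (.inl (.inl ⟨a + 1, n, by omega⟩))
    · exact .inl (.inl (.inr ⟨a + 1, n, by omega⟩))
    · exact .inl (.inr ⟨b + 1, n, by omega⟩)
    · exact .inr ⟨b + 1, n, by omega⟩

theorem mem_N0_iff {a b c d : ℕ} :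
    (a + 1, b + 1, c + 1, d + 1) ∈ N0 ↔ a ^^^ c = 1 ∧ b ^^^ d = 1 := by
  simp only [N0, xor_eq_one_iff, Set.mem_union, Set.mem_ofPred_eq, Prod.mk.injEq]
  constructor
  · rintro (((⟨m, n, h⟩ | ⟨m, n, h⟩) | ⟨m, n, h⟩) | ⟨m, n, h⟩) <;>
      exact ⟨⟨m, by omega⟩, n, by omega⟩
  · rintro ⟨⟨m, hm, h | h⟩, n, hn, h' | h'⟩
    · exact .inl (.inr ⟨m, n, by omega⟩)
    · exact .inr ⟨m, n, by omega⟩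
    · exact .inl (.inl (.inr ⟨m, n, by omega⟩))
    · exact .inl (.inl (.inl ⟨m, n, by omega⟩))

theorem isBalanced_iff_mem {a b c d : ℕ} (hne : (a, b) ≠ (c, d)) :
    IsBalanced a b c d ↔ (a + 1, b + 1, c + 1, d + 1) ∈ (P0 ∪ P1) \ N0 := by
  have h0 : ¬ (a ^^^ c = 0 ∧ b ^^^ d = 0) := by simpa [Nat.xor_eq_zero_iff] using hne
  rw [Set.mem_sdiff, Set.mem_union, mem_P0_iff, mem_P1_iff, mem_N0_iff, IsBalanced,
    Equiv.swap_apply_def]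
  split_ifs <;> omega

/-- In the two-dimensional Silver Dollar game without pushing and with jumps allowed,
a position `(w, x, y, z)` with both coins on the board is a P-position if and only if
it belongs to `(P₀ ∪ P₁) − N₀`. -/
theorem silverDollar_without_push_PPositions (w x y z : ℕ)
    (hw : 1 ≤ w) (hx : 1 ≤ x) (hy : 1 ≤ y) (hz : 1 ≤ z)
    (hne : (w, x) ≠ (y, z)) :
    PPosition JumpMove (some (w, x), some (y, z)) ↔
      (w, x, y, z) ∈ (P0 ∪ P1) \ N0 := by
  obtain ⟨a, rfl⟩ := Nat.exists_eq_add_of_le' hw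
  obtain ⟨b, rfl⟩ := Nat.exists_eq_add_of_le' hx
  obtain ⟨c, rfl⟩ := Nat.exists_eq_add_of_le' hy
  obtain ⟨d, rfl⟩ := Nat.exists_eq_add_of_le' hz
  have hne' : (a, b) ≠ (c, d) := by simpa using hne
  rw [← isBalanced_iff_mem hne', ← pPosition_coinPair_iff hne']
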